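/- Let a > 0 and let τ ∈ (0, a²/4) be the unique zero of μ ↦ r(y_ub(μ); μ). For 0 < μ < τ, the gradient equation ∇g_μ(x,y) = 0 has exactly three solutions with x > 0 and y > 0, denoted (x*_μ, y*_μ), (x**_μ, y**_μ), (x***_μ, y***_μ) with x***_μ < x**_μ < x*_μ. As μ → 0⁺ these converge respectively to (a, 0), (0, 0), and (0, a/(a²+1)). -/

import Mathlib

open Filter Topology

/-- `g_μ(x, y) = (μ/2)((1 - a y)² + y² + (a - x)² + 1) + x² y² / 2`, as a function
on `ℝ × ℝ`. -/
noncomputable def g (a μ : ℝ) (q : ℝ × ℝ) : ℝ :=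
  μ / 2 * ((1 - a * q.2) ^ 2 + q.2 ^ 2 + (a - q.1) ^ 2 + 1) + q.1 ^ 2 * q.2 ^ 2 / 2

/-- A positive critical point of `g_μ`: `x > 0`, `y > 0` and `∇g_μ(x,y) = 0`. -/
def IsCrit (a μ : ℝ) (q : ℝ × ℝ) : Prop :=
  0 < q.1 ∧ 0 < q.2 ∧ fderiv ℝ (g a μ) q = 0

/-- `r(y; μ)`. -/
noncomputable def r (a μ y : ℝ) : ℝ :=
  a / y - μ * a ^ 2 / (y ^ 2 + μ) ^ 2 - (a ^ 2 + 1)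

/-- `y_ub(μ)`. -/
noncomputable def yub (a μ : ℝ) : ℝ :=
  (4 * μ) ^ ((1 : ℝ) / 3) / 2 *
    (a ^ ((1 : ℝ) / 3) + Real.sqrt (a ^ ((2 : ℝ) / 3) - (4 * μ) ^ ((1 : ℝ) / 3)))

lemma g_hasFDerivAt (a μ : ℝ) (q : ℝ × ℝ) :
    HasFDerivAt (g a μ)
      ((-(μ * (a - q.1)) + q.1 * q.2 ^ 2) • ContinuousLinearMap.fst ℝ ℝ ℝ +
       (μ * (-(a * (1 - a * q.2)) + q.2) + q.1 ^ 2 * q.2) • ContinuousLinearMap.snd ℝ ℝ ℝ) q := by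
  have h1 : HasFDerivAt (fun q : ℝ × ℝ => q.1) (ContinuousLinearMap.fst ℝ ℝ ℝ) q := hasFDerivAt_fst
  have h2 : HasFDerivAt (fun q : ℝ × ℝ => q.2) (ContinuousLinearMap.snd ℝ ℝ ℝ) q := hasFDerivAt_snd
  have h := ((((((h2.const_mul a).const_sub 1).pow 2).add (h2.pow 2)).add
    ((h1.const_sub a).pow 2)).add_const 1).const_mul (μ / 2) |>.add
    (((h1.pow 2).mul (h2.pow 2)).mul_const (1 / 2 : ℝ))
  have h' := h.congr_of_eventuallyEq (f₁ := g a μ) (Filter.Eventually.of_forall fun x => by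
    simp [g]; ring)
  refine h'.congr_fderiv ?_
  ext <;> simp <;> ring

lemma isCrit_iff (a μ : ℝ) (ha : 0 < a) (hμ : 0 < μ) (q : ℝ × ℝ) :
    IsCrit a μ q ↔ 0 < q.2 ∧ q.1 = μ * a / (μ + q.2 ^ 2) ∧ r a μ q.2 = 0 := by
  obtain ⟨x, y⟩ := q
  have key : fderiv ℝ (g a μ) (x, y) = 0 ↔ (-(μ * (a - x)) + x * y ^ 2 = 0 ∧
      μ * (-(a * (1 - a * y)) + y) + x ^ 2 * y = 0) := by
    rw [(g_hasFDerivAt a μ (x, y)).fderiv]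
    constructor
    · intro h
      have e1 := congrArg (fun L => L (1, 0)) h
      have e2 := congrArg (fun L => L (0, 1)) h
      simp at e1 e2
      exact ⟨by linarith, by linarith⟩
    · rintro ⟨e1, e2⟩
      simp only [e1, e2]
      simp
  have hp : 0 < μ + y ^ 2 := by positivity
  have hr : 0 < y → ∀ x, x = μ * a / (μ + y ^ 2) →
      (r a μ y = 0 ↔ μ * (-(a * (1 - a * y)) + y) + x ^ 2 * y = 0) := by
    intro hy x hx
    have : μ * (-(a * (1 - a * y)) + y) + x ^ 2 * y = - (μ * y) * r a μ y := by
      rw [hx, r]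
      have : y ^ 2 + μ ≠ 0 := by positivity
      field_simp
      ring
    rw [this]
    simp [hμ.ne', hy.ne']
  have hx : -(μ * (a - x)) + x * y ^ 2 = 0 ↔ x = μ * a / (μ + y ^ 2) := by
    rw [eq_div_iff hp.ne']
    constructor <;> intro h <;> linarith
  simp only [IsCrit, key, hx]
  constructor
  · rintro ⟨_, hy, h1, h2⟩
    exact ⟨hy, h1, (hr hy x h1).2 h2⟩
  · rintro ⟨hy, h1, h2⟩
    exact ⟨by rw [h1]; positivity, hy, h1, (hr hy x h1).1 h2⟩

lemma r_hasDerivAt (a μ y : ℝ) (hμ : 0 < μ) (hy : 0 < y) :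
    HasDerivAt (r a μ) (a * (4 * μ * a * y ^ 3 - (y ^ 2 + μ) ^ 3) / (y ^ 2 * (y ^ 2 + μ) ^ 3)) y := by
  have hp : y ^ 2 + μ ≠ 0 := by positivity
  have h := (((hasDerivAt_const y a).div (hasDerivAt_id y) hy.ne').sub
    ((hasDerivAt_const y (μ * a ^ 2)).div ((((hasDerivAt_id y).pow 2).add_const μ).pow 2)
      (by simpa using hp))).sub_const (a ^ 2 + 1)
  have h' := h.congr_of_eventuallyEq (f₁ := r a μ) (Filter.Eventually.of_forall fun x => by
    simp [r])
  refine h'.congr_deriv ?_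
  simp
  field_simp
  ring

lemma r_cont (a μ : ℝ) (hμ : 0 < μ) : ContinuousOn (r a μ) (Set.Ioi 0) := fun y hy =>
  (r_hasDerivAt a μ y hμ hy).continuousAt.continuousWithinAt

lemma yub_cont (a : ℝ) : Continuous (yub a) := by
  have h : Continuous fun μ : ℝ => (4 * μ) ^ ((1 : ℝ) / 3) :=
    (continuous_const.mul continuous_id).rpow_const (fun _ => Or.inr (by norm_num))
  unfold yub
  fun_prop

lemma yub_tendsto (a : ℝ) : Tendsto (yub a) (𝓝[>] 0) (𝓝 0) := by
  have h := (yub_cont a).tendsto 0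
  have : yub a 0 = 0 := by
    simp [yub]
  rw [this] at h
  exact h.mono_left nhdsWithin_le_nhds

lemma yub_facts (a μ : ℝ) (ha : 0 < a) (hμ : 0 < μ) (hμa : μ < a ^ 2 / 4) :
    ∃ c : ℝ, 0 < c ∧ c ^ 3 = 4 * μ * a ∧ yub a μ ^ 2 + μ = c * yub a μ ∧ 0 < yub a μ ∧
      μ < yub a μ ^ 2 := by
  set s := (4 * μ) ^ ((1 : ℝ) / 3) with hs
  set t := a ^ ((1 : ℝ) / 3) with ht
  have hs0 : 0 < s := by positivity
  have ht0 : 0 < t := by positivity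
  have hs3 : s ^ 3 = 4 * μ := by
    rw [hs, ← Real.rpow_natCast, ← Real.rpow_mul (by positivity)]; norm_num
  have ht3 : t ^ 3 = a := by
    rw [ht, ← Real.rpow_natCast, ← Real.rpow_mul (by positivity)]; norm_num
  have ht2 : a ^ ((2 : ℝ) / 3) = t ^ 2 := by
    rw [ht, ← Real.rpow_natCast, ← Real.rpow_mul (by positivity)]; norm_num
  have hst : s < t ^ 2 := by
    refine lt_of_pow_lt_pow_left₀ 3 (by positivity) ?_
    have : (t ^ 2) ^ 3 = (t ^ 3) ^ 2 := by ring
    rw [this, hs3, ht3]; linarith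
  have hy : yub a μ = s / 2 * (t + √(t ^ 2 - s)) := by
    rw [yub, ht2]
  set d := √(t ^ 2 - s) with hd
  have hd2 : d ^ 2 = t ^ 2 - s := Real.sq_sqrt (by linarith)
  have hd0 : 0 < d := Real.sqrt_pos.2 (by linarith)
  have hw : yub a μ ^ 2 + μ = s * t * yub a μ := by
    rw [hy]
    have : μ = s ^ 3 / 4 := by linarith
    rw [this]
    linear_combination (s ^ 2 / 4) * hd2
  refine ⟨s * t, by positivity, by rw [mul_pow, hs3, ht3], hw, by rw [hy]; positivity, ?_⟩
  rw [hy]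
  have : μ = s ^ 3 / 4 := by linarith
  rw [this]
  have e : (s / 2 * (t + d)) ^ 2 - s ^ 3 / 4 = s ^ 2 / 4 * (2 * d ^ 2 + 2 * t * d) := by
    linear_combination (-s ^ 2 / 4) * hd2
  have : 0 < s ^ 2 / 4 * (2 * d ^ 2 + 2 * t * d) := by positivity
  linarith

lemma r_yub_lower (a μ : ℝ) (ha : 0 < a) (hμ : 0 < μ) (hμa : μ < a ^ 2 / 4) :
    a / (2 * yub a μ) - (a ^ 2 + 1) ≤ r a μ (yub a μ) := by
  obtain ⟨c, hc, hc3, hw, hw0, hwμ⟩ := yub_facts a μ ha hμ hμa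
  set w := yub a μ
  have h3 : (w ^ 2 + μ) ^ 3 = 4 * μ * a * w ^ 3 := by rw [hw, mul_pow, hc3]
  have h2 : 2 * μ * a * w ≤ (w ^ 2 + μ) ^ 2 := by
    refine le_of_mul_le_mul_right ?_ (by positivity : 0 < w ^ 2 + μ)
    have : 0 ≤ 2 * μ * a * w * (w ^ 2 - μ) := by
      have := sub_pos.2 hwμ
      positivity
    nlinarith
  have : μ * a ^ 2 / (w ^ 2 + μ) ^ 2 ≤ a / (2 * w) := by
    rw [div_le_div_iff₀ (by positivity) (by positivity)]
    nlinarith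
  have e : a / w = a / (2 * w) + a / (2 * w) := by field_simp; ring
  unfold r
  linarith

lemma r_yub_pos (a τ : ℝ) (ha : 0 < a)
    (hτ : τ ∈ Set.Ioo 0 (a ^ 2 / 4))
    (hτuniq : ∀ μ ∈ Set.Ioo 0 (a ^ 2 / 4), r a μ (yub a μ) = 0 → μ = τ)
    (μ : ℝ) (hμ : μ ∈ Set.Ioo 0 τ) : 0 < r a μ (yub a μ) := by
  by_contra hneg
  push Not at hneg
  have hev : ∀ᶠ ν in 𝓝[>] (0 : ℝ), yub a ν < a / (2 * (a ^ 2 + 1)) :=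
    (yub_tendsto a).eventually_lt_const (by positivity)
  have hev2 : ∀ᶠ ν in 𝓝[>] (0 : ℝ), ν ∈ Set.Ioo 0 μ := Ioo_mem_nhdsGT hμ.1
  obtain ⟨ν, h1, h2⟩ := (hev.and hev2).exists
  have hνa : ν < a ^ 2 / 4 := h2.2.trans (hμ.2.trans hτ.2)
  have hpos : 0 ≤ r a ν (yub a ν) := by
    have hl := r_yub_lower a ν ha h2.1 hνa
    obtain ⟨c, hc, hc3, hw, hw0, hwμ⟩ := yub_facts a ν ha h2.1 hνa
    have : a ^ 2 + 1 ≤ a / (2 * yub a ν) := by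
      rw [le_div_iff₀ (by positivity)]
      rw [lt_div_iff₀ (by positivity)] at h1
      linarith
    linarith
  have hcont : ContinuousOn (fun ξ => r a ξ (yub a ξ)) (Set.Icc ν μ) := by
    have hy := (yub_cont a).continuousOn (s := Set.Icc ν μ)
    unfold r
    refine ((continuousOn_const.div hy ?_).sub (ContinuousOn.div ?_ ?_ ?_)).sub continuousOn_const
    · intro ξ hξ
      obtain ⟨c, hc, hc3, hw, hw0, hwμ⟩ := yub_facts a ξ ha (by linarith [h2.1, hξ.1])
        (by linarith [hξ.2, hμ.2, hτ.2])
      exact hw0.ne'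
    · fun_prop
    · exact ((hy.pow 2).add continuousOn_id).pow 2
    · intro ξ hξ
      have : 0 < ξ := by linarith [h2.1, hξ.1]
      positivity
  obtain ⟨ξ, hξ, h0⟩ := intermediate_value_Icc' h2.2.le hcont ⟨hneg, hpos⟩
  have := hτuniq ξ ⟨by linarith [h2.1, hξ.1], by linarith [hξ.2, hμ.2, hτ.2]⟩ h0
  linarith [hξ.2, hμ.2]

lemma three_roots (a μ c w : ℝ) (ha : 0 < a) (hμ : 0 < μ) (hc : 0 < c) (hc3 : c ^ 3 = 4 * μ * a)
    (hw : w ^ 2 + μ = c * w) (hw0 : 0 < w) (hwμ : μ < w ^ 2) (hrw : 0 < r a μ w) :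
    ∃ y₁ y₂ y₃ : ℝ, (0 < y₁ ∧ y₁ < √μ ∧ √μ < y₂ ∧ y₂ < w ∧ w < y₃) ∧
      (r a μ y₁ = 0 ∧ r a μ y₂ = 0 ∧ r a μ y₃ = 0) ∧
      (∀ y, 0 < y → r a μ y = 0 → y = y₁ ∨ y = y₂ ∨ y = y₃) ∧
      (∀ z, w < z → 0 < r a μ z → z < y₃) := by
  have hm0 : 0 < √μ := Real.sqrt_pos.2 hμ
  have hm2 : √μ ^ 2 = μ := Real.sq_sqrt hμ.le
  have hmw : √μ < w := Real.sqrt_lt' hw0 |>.2 hwμ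
  obtain ⟨u, hu⟩ : ∃ u, u = μ / w := ⟨_, rfl⟩
  have huw : u * w = μ := by rw [hu]; field_simp
  have hu0 : 0 < u := by rw [hu]; positivity
  have hcu : c = u + w := by
    have : c * w = (u + w) * w := by linarith
    exact mul_right_cancel₀ hw0.ne' this
  have hum : u < √μ := by
    by_contra h
    push Not at h
    nlinarith
  have hcont := r_cont a μ hμ
  -- derivative signs
  have hfac : ∀ y, 4 * μ * a * y ^ 3 - (y ^ 2 + μ) ^ 3 =
      -((y - u) * (y - w)) * ((c * y) ^ 2 + c * y * (y ^ 2 + μ) + (y ^ 2 + μ) ^ 2) := by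
    intro y
    have : (y - u) * (y - w) = y ^ 2 + μ - c * y := by rw [hcu, ← huw]; ring
    rw [this, ← hc3]; ring
  have hdneg : ∀ y, 0 < y → 0 < (y - u) * (y - w) → deriv (r a μ) y < 0 := by
    intro y hy h
    rw [(r_hasDerivAt a μ y hμ hy).deriv, hfac]
    apply div_neg_of_neg_of_pos _ (by positivity)
    apply mul_neg_of_pos_of_neg ha
    apply mul_neg_of_neg_of_pos (by linarith) (by positivity)
  have hdpos : ∀ y, 0 < y → (y - u) * (y - w) < 0 → 0 < deriv (r a μ) y := by
    intro y hy h
    rw [(r_hasDerivAt a μ y hμ hy).deriv, hfac]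
    apply div_pos _ (by positivity)
    apply mul_pos ha
    apply mul_pos (by linarith) (by positivity)
  have anti1 : StrictAntiOn (r a μ) (Set.Ioc 0 u) := by
    apply strictAntiOn_of_deriv_neg (convex_Ioc 0 u) (hcont.mono fun y hy => hy.1)
    intro y hy
    rw [interior_Ioc] at hy
    exact hdneg y hy.1 (mul_pos_of_neg_of_neg (by linarith [hy.2]) (by linarith [hy.2]))
  have mono2 : StrictMonoOn (r a μ) (Set.Icc u w) := by
    apply strictMonoOn_of_deriv_pos (convex_Icc u w) (hcont.mono fun y hy => lt_of_lt_of_le hu0 hy.1)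
    intro y hy
    rw [interior_Icc] at hy
    exact hdpos y (hu0.trans hy.1) (mul_neg_of_pos_of_neg (by linarith [hy.1]) (by linarith [hy.2]))
  have anti3 : StrictAntiOn (r a μ) (Set.Ici w) := by
    apply strictAntiOn_of_deriv_neg (convex_Ici w) (hcont.mono fun y hy => lt_of_lt_of_le hw0 hy)
    intro y hy
    rw [interior_Ici] at hy
    have : w < y := hy
    exact hdneg y (hw0.trans hy) (mul_pos (by linarith) (by linarith))
  have hrm : r a μ (√μ) < 0 := by
    have : r a μ (√μ) = -(a / (2 * √μ) - 1) ^ 2 - a ^ 2 := by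
      unfold r
      rw [hm2]
      have : μ * a ^ 2 / (μ + μ) ^ 2 = (a / (2 * √μ)) ^ 2 := by
        rw [div_pow, mul_pow, hm2]; field_simp; ring
      rw [this]
      field_simp
      ring
    rw [this]
    have := sq_nonneg (a / (2 * √μ) - 1)
    have : 0 < a ^ 2 := by positivity
    linarith
  -- y₁
  obtain ⟨y₁, hy1, hr1⟩ : ∃ y ∈ Set.Ioo 0 (√μ), r a μ y = 0 := by
    set B := a ^ 2 / μ + a ^ 2 + 1 with hB
    have hB0 : 0 < B := by positivity
    set z := min (a / (B + 1)) (√μ / 2) with hz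
    have hz0 : 0 < z := by positivity
    have hzm : z < √μ := lt_of_le_of_lt (min_le_right _ _) (by linarith)
    have hza : B + 1 ≤ a / z := by
      have : z ≤ a / (B + 1) := min_le_left _ _
      rw [le_div_iff₀ (by positivity)] at this
      rw [le_div_iff₀ hz0]; linarith
    have hrz : 0 < r a μ z := by
      have : μ * a ^ 2 / (z ^ 2 + μ) ^ 2 ≤ a ^ 2 / μ := by
        rw [div_le_div_iff₀ (by positivity) hμ]
        have : μ ^ 2 ≤ (z ^ 2 + μ) ^ 2 := by
          apply pow_le_pow_left₀ hμ.le; nlinarith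
        nlinarith [sq_nonneg a]
      unfold r; linarith
    obtain ⟨y, hy, h0⟩ := intermediate_value_Ioo' hzm.le
      (hcont.mono fun y hy => lt_of_lt_of_le hz0 hy.1) ⟨hrm, hrz⟩
    exact ⟨y, ⟨hz0.trans hy.1, hy.2⟩, h0⟩
  obtain ⟨y₂, hy2, hr2⟩ := intermediate_value_Ioo hmw.le
      (hcont.mono fun y hy => lt_of_lt_of_le hm0 hy.1) ⟨hrm, hrw⟩
  obtain ⟨y₃, hy3, hr3⟩ : ∃ y ∈ Set.Ioi w, r a μ y = 0 := by
    set z := a / (a ^ 2 + 1) with hz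
    have hz0 : 0 < z := by positivity
    have hwz : w < z := by
      rw [hz, lt_div_iff₀ (by positivity)]
      have h1 : 0 < μ * a ^ 2 / (w ^ 2 + μ) ^ 2 := by positivity
      have h2 : a ^ 2 + 1 < a / w := by unfold r at hrw; linarith
      rw [lt_div_iff₀ hw0] at h2
      linarith
    have hrz : r a μ z < 0 := by
      have h1 : 0 < μ * a ^ 2 / (z ^ 2 + μ) ^ 2 := by positivity
      have h2 : a / z = a ^ 2 + 1 := by rw [hz]; field_simp
      unfold r; linarith
    obtain ⟨y, hy, h0⟩ := intermediate_value_Ioo' hwz.le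
      (hcont.mono fun y hy => lt_of_lt_of_le hw0 hy.1) ⟨hrz, hrw⟩
    exact ⟨y, hy.1, h0⟩
  have hy3 : w < y₃ := hy3
  have low : ∀ y, 0 < y → y < √μ → r a μ y = 0 → y ≤ u := by
    intro y hy hym h
    by_contra hlt
    push Not at hlt
    have := mono2 ⟨hlt.le, by linarith⟩ ⟨hum.le, hmw.le⟩ hym
    linarith
  refine ⟨y₁, y₂, y₃, ⟨hy1.1, hy1.2, hy2.1, hy2.2, hy3⟩, ⟨hr1, hr2, hr3⟩, ?_, ?_⟩
  · intro y hy h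
    rcases lt_or_ge y (√μ) with h1 | h1
    · left
      exact anti1.injOn ⟨hy, low y hy h1 h⟩ ⟨hy1.1, low _ hy1.1 hy1.2 hr1⟩ (h.trans hr1.symm)
    · right
      rcases le_or_gt y w with h2 | h2
      · left
        exact mono2.injOn ⟨by linarith, h2⟩ ⟨by linarith [hy2.1], hy2.2.le⟩ (h.trans hr2.symm)
      · right
        exact anti3.injOn h2.le hy3.le (h.trans hr3.symm)
  · intro z hz hrz
    by_contra hle
    push Not at hle
    have := anti3.antitoneOn hy3.le hz.le hle
    linarith

lemma x_sq_bound (a μ y : ℝ) (hμ : 0 < μ) (hy : 0 < y) (h : r a μ y = 0) :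
    (μ * a / (μ + y ^ 2)) ^ 2 * y + μ * (a ^ 2 + 1) * y = μ * a := by
  unfold r at h
  have : (μ * a / (μ + y ^ 2)) ^ 2 = μ * (μ * a ^ 2 / (y ^ 2 + μ) ^ 2) := by
    rw [add_comm μ]; field_simp
  rw [this]
  have e : a / y * y = a := by field_simp
  linear_combination (-μ * y) * h + μ * e

/-- for `0 < μ < τ` the equation `∇g_μ = 0` has exactly three solutions
with `x, y > 0`, ordered by first coordinate, and as `μ → 0⁺` they converge to
`(a, 0)`, `(0, 0)` and `(0, a/(a²+1))` respectively. -/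
theorem stmt7 (a τ : ℝ) (ha : 0 < a)
    (hτ : τ ∈ Set.Ioo 0 (a ^ 2 / 4))
    (hτ0 : r a τ (yub a τ) = 0)
    (hτuniq : ∀ μ ∈ Set.Ioo 0 (a ^ 2 / 4), r a μ (yub a μ) = 0 → μ = τ) :
    ∃ P₁ P₂ P₃ : ℝ → ℝ × ℝ,
      (∀ μ ∈ Set.Ioo 0 τ,
        IsCrit a μ (P₁ μ) ∧ IsCrit a μ (P₂ μ) ∧ IsCrit a μ (P₃ μ) ∧
        (P₃ μ).1 < (P₂ μ).1 ∧ (P₂ μ).1 < (P₁ μ).1 ∧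
        (∀ q : ℝ × ℝ, IsCrit a μ q → q = P₁ μ ∨ q = P₂ μ ∨ q = P₃ μ)) ∧
      Tendsto P₁ (𝓝[>] (0 : ℝ)) (𝓝 (a, 0)) ∧
      Tendsto P₂ (𝓝[>] (0 : ℝ)) (𝓝 ((0 : ℝ), (0 : ℝ))) ∧
      Tendsto P₃ (𝓝[>] (0 : ℝ)) (𝓝 (0, a / (a ^ 2 + 1))) := by
  have H : ∀ μ, μ ∈ Set.Ioo 0 τ → ∃ y₁ y₂ y₃ : ℝ,
      (0 < y₁ ∧ y₁ < √μ ∧ √μ < y₂ ∧ y₂ < yub a μ ∧ yub a μ < y₃) ∧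
      (r a μ y₁ = 0 ∧ r a μ y₂ = 0 ∧ r a μ y₃ = 0) ∧
      (∀ y, 0 < y → r a μ y = 0 → y = y₁ ∨ y = y₂ ∨ y = y₃) ∧
      (∀ z, yub a μ < z → 0 < r a μ z → z < y₃) := by
    intro μ hμ
    obtain ⟨c, hc, hc3, hw, hw0, hwμ⟩ := yub_facts a μ ha hμ.1 (hμ.2.trans hτ.2)
    exact three_roots a μ c _ ha hμ.1 hc hc3 hw hw0 hwμ (r_yub_pos a τ ha hτ hτuniq μ hμ)
  choose! y₁ y₂ y₃ hord hr huniq hlow using H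
  have hev : ∀ᶠ μ in 𝓝[>] (0 : ℝ), μ ∈ Set.Ioo 0 τ := Ioo_mem_nhdsGT hτ.1
  have hsqrt : Tendsto (fun μ : ℝ => √μ) (𝓝[>] (0 : ℝ)) (𝓝 0) := by
    have := Real.continuous_sqrt.tendsto 0
    rw [Real.sqrt_zero] at this
    exact this.mono_left nhdsWithin_le_nhds
  have hid : Tendsto (fun μ : ℝ => μ) (𝓝[>] (0 : ℝ)) (𝓝 0) := nhdsWithin_le_nhds
  -- x tends to 0 if y is above √μ
  have hx0 : ∀ y : ℝ → ℝ, (∀ μ ∈ Set.Ioo 0 τ, √μ < y μ ∧ r a μ (y μ) = 0) →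
      Tendsto (fun μ => μ * a / (μ + y μ ^ 2)) (𝓝[>] (0 : ℝ)) (𝓝 0) := by
    intro y hy
    have hb : Tendsto (fun μ : ℝ => √(√μ * a)) (𝓝[>] (0 : ℝ)) (𝓝 0) := by
      have : Continuous fun μ : ℝ => √(√μ * a) := by fun_prop
      have := this.tendsto 0
      simp only [Real.sqrt_zero, zero_mul] at this
      exact this.mono_left nhdsWithin_le_nhds
    refine tendsto_of_tendsto_of_tendsto_of_le_of_le' tendsto_const_nhds hb ?_ ?_
    · filter_upwards [hev] with μ hμ
      have := hμ.1
      positivity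
    · filter_upwards [hev] with μ hμ
      obtain ⟨h1, h2⟩ := hy μ hμ
      have hμ0 := hμ.1
      have hm0 : 0 < √μ := Real.sqrt_pos.2 hμ0
      have hm2 : √μ ^ 2 = μ := Real.sq_sqrt hμ0.le
      have hy0 : 0 < y μ := hm0.trans h1
      have hb := x_sq_bound a μ (y μ) hμ0 hy0 h2
      apply Real.le_sqrt_of_sq_le
      set X := μ * a / (μ + y μ ^ 2)
      have h3 : X ^ 2 * y μ ≤ μ * a := by
        have : 0 < μ * (a ^ 2 + 1) * y μ := by positivity
        linarith
      have h4 : X ^ 2 * √μ ≤ √μ * a * √μ := by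
        calc X ^ 2 * √μ ≤ X ^ 2 * y μ := by gcongr
          _ ≤ μ * a := h3
          _ = √μ * a * √μ := by linear_combination (-a) * hm2
      exact le_of_mul_le_mul_right h4 hm0
  have hxlt : ∀ μ y z : ℝ, 0 < μ → 0 < y → y < z → μ * a / (μ + z ^ 2) < μ * a / (μ + y ^ 2) := by
    intro μ y z h1 h2 h3
    gcongr
  refine ⟨fun μ => (μ * a / (μ + y₁ μ ^ 2), y₁ μ), fun μ => (μ * a / (μ + y₂ μ ^ 2), y₂ μ),
    fun μ => (μ * a / (μ + y₃ μ ^ 2), y₃ μ), ?_, ?_, ?_, ?_⟩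
  · intro μ hμ
    have hμ0 := hμ.1
    obtain ⟨o1, o2, o3, o4, o5⟩ := hord μ hμ
    obtain ⟨r1, r2, r3⟩ := hr μ hμ
    have hm0 : 0 < √μ := Real.sqrt_pos.2 hμ0
    simp only [isCrit_iff a μ ha hμ0]
    refine ⟨⟨o1, trivial, r1⟩, ⟨by linarith, trivial, r2⟩, ⟨by linarith, trivial, r3⟩,
      hxlt _ _ _ hμ0 (by linarith) (by linarith), hxlt _ _ _ hμ0 (by linarith) (by linarith), ?_⟩
    rintro ⟨x, y⟩ ⟨hy, hx, h0⟩
    simp only at hy hx h0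
    rcases huniq μ hμ y hy h0 with h | h | h
    · left; rw [hx, h]
    · right; left; rw [hx, h]
    · right; right; rw [hx, h]
  · refine Tendsto.prodMk_nhds ?_ ?_
    · have hlb : Tendsto (fun μ : ℝ => a - 16 * μ / a) (𝓝[>] (0 : ℝ)) (𝓝 a) := by
        have : Continuous fun μ : ℝ => a - 16 * μ / a := by fun_prop
        have := this.tendsto 0
        simp at this
        exact this.mono_left nhdsWithin_le_nhds
      refine tendsto_of_tendsto_of_tendsto_of_le_of_le' hlb tendsto_const_nhds ?_ ?_
      · filter_upwards [hev] with μ hμ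
        have hμ0 := hμ.1
        obtain ⟨o1, o2, -⟩ := hord μ hμ
        have hb := x_sq_bound a μ (y₁ μ) hμ0 o1 (hr μ hμ).1
        set y := y₁ μ
        have hy2 : y ^ 2 < μ := by
          rw [← Real.sq_sqrt hμ0.le]
          exact pow_lt_pow_left₀ o2 o1.le (by norm_num)
        have hxa : a / 2 ≤ μ * a / (μ + y ^ 2) := by
          rw [div_le_div_iff₀ (by norm_num) (by positivity)]
          nlinarith
        have hx2 : (a / 2) ^ 2 ≤ (μ * a / (μ + y ^ 2)) ^ 2 := by gcongr
        have hya : a * y ≤ 4 * μ := by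
          have h5 : (a / 2) ^ 2 * y ≤ μ * a := by
            have : 0 < μ * (a ^ 2 + 1) * y := by positivity
            have : (a / 2) ^ 2 * y ≤ (μ * a / (μ + y ^ 2)) ^ 2 * y := by gcongr
            linarith
          refine le_of_mul_le_mul_left ?_ ha
          nlinarith
        have hya2 : a ^ 2 * y ^ 2 ≤ 16 * μ ^ 2 := by
          have := pow_le_pow_left₀ (by positivity) hya 2
          nlinarith
        have e : a - μ * a / (μ + y ^ 2) = a * y ^ 2 / (μ + y ^ 2) := by field_simp; ring
        have : a * y ^ 2 / (μ + y ^ 2) ≤ 16 * μ / a := by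
          rw [div_le_div_iff₀ (by positivity) ha]
          have : 0 ≤ μ * y ^ 2 := by positivity
          nlinarith
        linarith
      · filter_upwards [hev] with μ hμ
        have hμ0 := hμ.1
        rw [div_le_iff₀ (by positivity)]
        have : 0 ≤ a * y₁ μ ^ 2 := by positivity
        linarith
    · refine tendsto_of_tendsto_of_tendsto_of_le_of_le' tendsto_const_nhds hsqrt ?_ ?_
      · filter_upwards [hev] with μ hμ using (hord μ hμ).1.le
      · filter_upwards [hev] with μ hμ using (hord μ hμ).2.1.le
  · refine Tendsto.prodMk_nhds ?_ ?_
    · exact hx0 y₂ fun μ hμ => ⟨(hord μ hμ).2.2.1, (hr μ hμ).2.1⟩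
    · refine tendsto_of_tendsto_of_tendsto_of_le_of_le' hsqrt (yub_tendsto a) ?_ ?_
      · filter_upwards [hev] with μ hμ using (hord μ hμ).2.2.1.le
      · filter_upwards [hev] with μ hμ using (hord μ hμ).2.2.2.1.le
  · refine Tendsto.prodMk_nhds ?_ ?_
    · refine hx0 y₃ fun μ hμ => ⟨?_, (hr μ hμ).2.2⟩
      obtain ⟨o1, o2, o3, o4, o5⟩ := hord μ hμ
      linarith
    · rw [tendsto_order]
      constructor
      · intro b hb
        obtain ⟨z, hz1, hz2⟩ := exists_between (max_lt hb (by positivity : 0 < a / (a ^ 2 + 1)))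
        have hz0 : 0 < z := (le_max_right _ _).trans_lt hz1
        have hbz : b < z := (le_max_left _ _).trans_lt hz1
        have hlim : Tendsto (fun μ => r a μ z) (𝓝[>] (0 : ℝ)) (𝓝 (a / z - (a ^ 2 + 1))) := by
          have hca : ContinuousAt (fun μ => r a μ z) 0 := by
            unfold r
            refine (continuousAt_const.sub (ContinuousAt.div (by fun_prop) (by fun_prop) ?_)).sub
              continuousAt_const
            positivity
          have := hca.tendsto
          simp only [r, zero_mul, zero_div, sub_zero] at this
          exact this.mono_left nhdsWithin_le_nhds
        have hpos : 0 < a / z - (a ^ 2 + 1) := by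
          rw [sub_pos, lt_div_iff₀ hz0]
          rw [lt_div_iff₀ (by positivity)] at hz2
          linarith
        filter_upwards [hev, hlim.eventually_const_lt hpos,
          (yub_tendsto a).eventually_lt_const hz0] with μ hμ h1 h2
        exact hbz.trans (hlow μ hμ z h2 h1)
      · intro b hb
        filter_upwards [hev] with μ hμ
        refine lt_trans ?_ hb
        have hμ0 := hμ.1
        obtain ⟨o1, o2, o3, o4, o5⟩ := hord μ hμ
        have hy0 : 0 < y₃ μ := by linarith
        have h0 := (hr μ hμ).2.2
        unfold r at h0
        have h1 : 0 < μ * a ^ 2 / (y₃ μ ^ 2 + μ) ^ 2 := by positivity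
        have h2 : a ^ 2 + 1 < a / y₃ μ := by linarith
        rw [lt_div_iff₀ hy0] at h2
        rw [lt_div_iff₀ (by positivity)]
        linarith
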